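/- If P is a partially ordered set that is not reversible, then P contains a subset (with the induced order) that is order-isomorphic to F_i or to the dual poset F_i^d for some i ∈ {1,...,8}. -/

import Mathlib

/-- A preordered set is *reversible* if every order-preserving bijection of it
onto itself has order-preserving inverse. -/
def Reversible (P : Type*) [Preorder P] : Prop :=
  ∀ f : P ≃ P, Monotone f → Monotone f.symm

/-- `D_∞`, the countably infinite antichain. -/
def Dinf : Type := ℕ

instance : PartialOrder Dinf where
  le a b := a = b
  le_refl _ := rfl
  le_trans _ _ _ h₁ h₂ := Eq.trans h₁ h₂
  le_antisymm _ _ h _ := h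

/-- `F₁ = D_∞ ⊔ ω`. -/
abbrev F1 : Type := Dinf ⊕ ℕ

/-- `F₂ = (D₁ ⊕ D_∞) ⊔ D_∞`. -/
abbrev F2 : Type := (PUnit ⊕ₗ Dinf) ⊕ Dinf

/-- `F₃ = D_∞ ⊔ (countably many two-element chains)`. -/
abbrev F3 : Type := Dinf ⊕ (Dinf × Bool)

/-- `F₄ = D_∞ ⊕ ω`. -/
abbrev F4 : Type := Dinf ⊕ₗ ℕ

/-- `F₅ = (D₁ ⊔ ω^d) ⊕ ω`. -/
abbrev F5 : Type := (PUnit ⊕ ℕᵒᵈ) ⊕ₗ ℕ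

/-- The poset `L` on `ℕ × {0,1}` with `(i,x) < (j,y)` iff `i > j`. -/
def L6 : Type := ℕ × Bool

/-- The order relation of `L6`. -/
def L6.le (a b : ℕ × Bool) : Prop := b.1 < a.1 ∨ a = b

instance : PartialOrder L6 where
  le := L6.le
  le_refl _ := Or.inr rfl
  le_trans a b c hab hbc := by
    rcases hab with h | h
    · rcases hbc with h' | h'
      · exact Or.inl (h'.trans h)
      · exact Or.inl (h' ▸ h)
    · rcases hbc with h' | h'
      · exact Or.inl (h ▸ h')
      · exact Or.inr (h.trans h')
  le_antisymm a b hab hba := by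
    rcases hab with h | h
    · rcases hba with h' | h'
      · exact absurd (h.trans h') (lt_irrefl _)
      · exact h'.symm
    · exact h

/-- `F₆ = L ⊕ ω`. -/
abbrev F6 : Type := L6 ⊕ₗ ℕ

/-- `F₇`: a chain `c₀ < c₁ < ⋯` (encoded `Sum.inr i = cᵢ`) together with pairwise
incomparable elements `a₁, a₂, …` (encoded `Sum.inl j = a_{j+1}`), where
`a_j < c_i` iff `i ≥ j`, and no other comparabilities. -/
def F7 : Type := ℕ ⊕ ℕ

/-- The order relation of `F₇`: `a_{j+1} ≤ cᵢ` iff `i ≥ j + 1`. -/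
def F7.le : F7 → F7 → Prop
  | Sum.inl j, Sum.inl j' => j = j'
  | Sum.inl j, Sum.inr i => j + 1 ≤ i
  | Sum.inr _, Sum.inl _ => False
  | Sum.inr i, Sum.inr i' => i ≤ i'

theorem F7.le_refl (x : F7) : F7.le x x := by cases x <;> simp [F7.le]
theorem F7.le_trans (x y z : F7) : F7.le x y → F7.le y z → F7.le x z := by
  cases x <;> cases y <;> cases z <;> simp [F7.le] <;> omega
theorem F7.le_antisymm (x y : F7) : F7.le x y → F7.le y x → x = y := by
  cases x <;> cases y <;> simp [F7.le] <;> intro h h' <;> exact congrArg _ (by omega)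

instance : PartialOrder F7 where
  le := F7.le
  le_refl := F7.le_refl
  le_trans := F7.le_trans
  le_antisymm := F7.le_antisymm

/-- `F₈`: on `{aᵢ : i ∈ ℤ} ∪ {bᵢ : i ∈ ℤ}` (encoded `Sum.inl i = aᵢ`,
`Sum.inr j = b_j`), the `aᵢ` pairwise incomparable, the `bᵢ` pairwise
incomparable, and `aᵢ < b_j` iff `i > 0` or `j ≠ i`. -/
def F8 : Type := ℤ ⊕ ℤ

/-- The order relation of `F₈`. -/
def F8.le : F8 → F8 → Prop
  | Sum.inl i, Sum.inl i' => i = i'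
  | Sum.inl i, Sum.inr j => 0 < i ∨ j ≠ i
  | Sum.inr _, Sum.inl _ => False
  | Sum.inr j, Sum.inr j' => j = j'

theorem F8.le_refl (x : F8) : F8.le x x := by cases x <;> simp [F8.le]
theorem F8.le_trans (x y z : F8) : F8.le x y → F8.le y z → F8.le x z := by
  cases x <;> cases y <;> cases z <;> simp [F8.le] <;> omega
theorem F8.le_antisymm (x y : F8) : F8.le x y → F8.le y x → x = y := by
  cases x <;> cases y <;> simp [F8.le] <;> intro h h' <;> exact congrArg _ (by omega)

instance : PartialOrder F8 where
  le := F8.le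
  le_refl := F8.le_refl
  le_trans := F8.le_trans
  le_antisymm := F8.le_antisymm

/-- `P` contains a subset (with the induced order) order-isomorphic to `F`. -/
def ContainsCopy (F : Type*) (P : Type*) [LE F] [LE P] : Prop :=
  ∃ S : Set P, Nonempty (F ≃o S)

/-- `P` contains a copy of one of `F₁, …, F₈`. -/
def ContainsForbidden (P : Type*) [PartialOrder P] : Prop :=
  ContainsCopy F1 P ∨ ContainsCopy F2 P ∨ ContainsCopy F3 P ∨ ContainsCopy F4 P ∨
  ContainsCopy F5 P ∨ ContainsCopy F6 P ∨ ContainsCopy F7 P ∨ ContainsCopy F8 P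

/-- `P` contains a copy of one of `F₁, …, F₈` or of one of their duals. -/
def ContainsForbiddenOrDual (P : Type*) [PartialOrder P] : Prop :=
  ContainsForbidden P ∨ ContainsForbidden Pᵒᵈ

section Constructors

theorem containsCopy_of_map {F P : Type*} [PartialOrder F] [PartialOrder P] (g : F → P)
    (hg : ∀ a b, g a ≤ g b ↔ a ≤ b) : ContainsCopy F P :=
  ⟨Set.range (OrderEmbedding.ofMapLEIff g hg), ⟨(OrderEmbedding.ofMapLEIff g hg).orderIso⟩⟩

theorem ContainsCopy.dual {F P : Type*} [PartialOrder F] [PartialOrder P]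
    (h : ContainsCopy F Pᵒᵈ) : ContainsCopy Fᵒᵈ P := by
  obtain ⟨S, ⟨e⟩⟩ := h
  refine containsCopy_of_map (fun a => OrderDual.ofDual (e (OrderDual.ofDual a) : Pᵒᵈ)) ?_
  intro a b
  rw [OrderDual.ofDual_le_ofDual, Subtype.coe_le_coe, e.le_iff_le, OrderDual.ofDual_le_ofDual]

variable {P : Type*} [PartialOrder P]

theorem containsCopy_F1 (a c : ℕ → P) (ha : ∀ i j, a i ≤ a j → i = j) (hc : StrictMono c)
    (hac : ∀ i j, ¬ a i ≤ c j) (hca : ∀ i j, ¬ c j ≤ a i) : ContainsCopy F1 P := by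
  refine containsCopy_of_map (F := F1) (Sum.elim a c) ?_
  rintro (i | i) (j | j)
  · refine Iff.trans ⟨fun h => ?_, fun h => ?_⟩ Sum.inl_le_inl_iff.symm
    · exact ha i j h
    · exact le_of_eq (congrArg a h)
  · exact iff_of_false (hac i j) Sum.not_inl_le_inr
  · exact iff_of_false (hca j i) Sum.not_inr_le_inl
  · exact hc.le_iff_le.trans Sum.inr_le_inr_iff.symm

theorem containsCopy_F2 (d : P) (a b : ℕ → P) (hda : ∀ i, d < a i) (ha : ∀ i j, a i ≤ a j → i = j)
    (hb : ∀ i j, b i ≤ b j → i = j) (hab : ∀ i j, ¬ a i ≤ b j) (hba : ∀ i j, ¬ b i ≤ a j)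
    (hdb : ∀ i, ¬ d ≤ b i) (hbd : ∀ i, ¬ b i ≤ d) : ContainsCopy F2 P := by
  refine containsCopy_of_map (F := F2)
    (Sum.elim (fun s => Sum.elim (fun _ => d) a (ofLex s)) b) ?_
  rintro ((i | i) | i) ((j | j) | j)
  · exact iff_of_true le_rfl (Sum.inl_le_inl_iff.2 le_rfl)
  · exact iff_of_true (hda j).le (Sum.inl_le_inl_iff.2 (Sum.Lex.inl_le_inr _ _))
  · exact iff_of_false (hdb j) Sum.not_inl_le_inr
  · exact iff_of_false (hda i).not_ge fun h => Sum.Lex.not_inr_le_inl (Sum.inl_le_inl_iff.1 h)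
  · refine Iff.trans ⟨fun h => ?_, fun h => ?_⟩
      (Sum.inl_le_inl_iff.trans Sum.Lex.inr_le_inr_iff).symm
    · exact ha i j h
    · exact le_of_eq (congrArg a h)
  · exact iff_of_false (hab i j) Sum.not_inl_le_inr
  · exact iff_of_false (hbd i) Sum.not_inr_le_inl
  · exact iff_of_false (hba i j) Sum.not_inr_le_inl
  · refine Iff.trans ⟨fun h => ?_, fun h => ?_⟩ Sum.inr_le_inr_iff.symm
    · exact hb i j h
    · exact le_of_eq (congrArg b h)

theorem containsCopy_F3 (d a b : ℕ → P) (hd : ∀ i j, d i ≤ d j → i = j)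
    (ha : ∀ i j, a i ≤ a j → i = j) (hb : ∀ i j, b i ≤ b j → i = j)
    (hab : ∀ i j, a i ≤ b j ↔ i = j) (hba : ∀ i j, ¬ b i ≤ a j)
    (hda : ∀ i j, ¬ d i ≤ a j) (had : ∀ i j, ¬ a i ≤ d j)
    (hdb : ∀ i j, ¬ d i ≤ b j) (hbd : ∀ i j, ¬ b i ≤ d j) : ContainsCopy F3 P := by
  refine containsCopy_of_map (F := F3)
    (Sum.elim d fun s : ℕ × Bool => bif s.2 then b s.1 else a s.1) ?_
  have key : ∀ (i j : Dinf) (s t : Bool),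
      (Sum.inr (i, s) : F3) ≤ Sum.inr (j, t) ↔ i = j ∧ s ≤ t := fun i j s t =>
    Sum.inr_le_inr_iff
  rintro (i | ⟨i, s⟩) (j | ⟨j, t⟩)
  · refine Iff.trans ⟨fun h => ?_, fun h => ?_⟩ Sum.inl_le_inl_iff.symm
    · exact hd i j h
    · exact le_of_eq (congrArg d h)
  · refine iff_of_false ?_ Sum.not_inl_le_inr
    cases t
    · exact hda i j
    · exact hdb i j
  · refine iff_of_false ?_ Sum.not_inr_le_inl
    cases s
    · exact had i j
    · exact hbd i j
  · rw [key]
    cases s <;> cases t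
    · exact ⟨fun h => ⟨ha i j h, le_rfl⟩, fun h => le_of_eq (congrArg a h.1)⟩
    · exact ⟨fun h => ⟨(hab i j).1 h, Bool.false_le _⟩, fun h => (hab i j).2 h.1⟩
    · exact iff_of_false (hba i j) fun h => absurd h.2 (by decide)
    · exact ⟨fun h => ⟨hb i j h, le_rfl⟩, fun h => le_of_eq (congrArg b h.1)⟩

theorem containsCopy_F4 (a c : ℕ → P) (ha : ∀ i j, a i ≤ a j → i = j) (hc : StrictMono c)
    (hac : ∀ i j, a i < c j) : ContainsCopy F4 P := by
  refine containsCopy_of_map (F := F4) (fun s => Sum.elim a c (ofLex s)) ?_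
  rintro (i | i) (j | j)
  · refine Iff.trans ⟨fun h => ?_, fun h => ?_⟩ Sum.Lex.inl_le_inl_iff.symm
    · exact ha i j h
    · exact le_of_eq (congrArg a h)
  · exact iff_of_true (hac i j).le (Sum.Lex.inl_le_inr _ _)
  · exact iff_of_false (hac j i).not_ge Sum.Lex.not_inr_le_inl
  · exact hc.le_iff_le.trans Sum.Lex.inr_le_inr_iff.symm

theorem containsCopy_F5 (d : P) (e c : ℕ → P) (he : StrictAnti e) (hc : StrictMono c)
    (hdc : ∀ j, d < c j) (hec : ∀ i j, e i < c j) (hde : ∀ i, ¬ d ≤ e i) (hed : ∀ i, ¬ e i ≤ d) :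
    ContainsCopy F5 P := by
  refine containsCopy_of_map (F := F5) (fun s => Sum.elim
    (Sum.elim (fun _ => d) fun i : ℕᵒᵈ => e (OrderDual.ofDual i)) c (ofLex s)) ?_
  rintro ((i | i) | i) ((j | j) | j)
  · exact iff_of_true le_rfl (Sum.Lex.inl_le_inl_iff.2 (Sum.inl_le_inl_iff.2 le_rfl))
  · exact iff_of_false (hde _) fun h => Sum.not_inl_le_inr (Sum.Lex.inl_le_inl_iff.1 h)
  · exact iff_of_true (hdc j).le (Sum.Lex.inl_le_inr _ _)
  · exact iff_of_false (hed _) fun h => Sum.not_inr_le_inl (Sum.Lex.inl_le_inl_iff.1 h)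
  · exact ⟨fun h => Sum.Lex.inl_le_inl_iff.2 (Sum.inr_le_inr_iff.2 (he.le_iff_ge.1 h)),
      fun h => he.le_iff_ge.2 (Sum.inr_le_inr_iff (a := i) (b := j) |>.1
        (Sum.Lex.inl_le_inl_iff.1 h))⟩
  · exact iff_of_true (hec _ j).le (Sum.Lex.inl_le_inr _ _)
  · exact iff_of_false (hdc i).not_ge Sum.Lex.not_inr_le_inl
  · exact iff_of_false (hec _ i).not_ge Sum.Lex.not_inr_le_inl
  · exact hc.le_iff_le.trans Sum.Lex.inr_le_inr_iff.symm

theorem containsCopy_F6 (p q c : ℕ → P) (hc : StrictMono c) (hpc : ∀ n j, p n < c j)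
    (hqc : ∀ n j, q n < c j) (hpq : ∀ n, ¬ p n ≤ q n) (hqp : ∀ n, ¬ q n ≤ p n)
    (hlt : ∀ m n, m < n → p n < p m ∧ p n < q m ∧ q n < p m ∧ q n < q m) :
    ContainsCopy F6 P := by
  let g : ℕ × Bool → P := fun s => bif s.2 then q s.1 else p s.1
  have hgc : ∀ s j, g s < c j := by
    rintro ⟨n, s⟩ j
    cases s
    · exact hpc n j
    · exact hqc n j
  have hg : ∀ {s t : ℕ × Bool}, t.1 < s.1 → g s < g t := by
    rintro ⟨m, s⟩ ⟨n, t⟩ h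
    obtain ⟨h1, h2, h3, h4⟩ := hlt n m h
    cases s <;> cases t <;> assumption
  have hg' : ∀ s t, g s ≤ g t ↔ L6.le s t := by
    intro s t
    refine ⟨fun h => ?_, fun h => ?_⟩
    · rcases lt_trichotomy t.1 s.1 with h' | h' | h'
      · exact Or.inl h'
      · obtain ⟨m, s⟩ := s
        obtain ⟨n, t⟩ := t
        obtain rfl : n = m := h'
        cases s <;> cases t
        · exact Or.inr rfl
        · exact absurd h (hpq n)
        · exact absurd h (hqp n)
        · exact Or.inr rfl
      · exact absurd h (hg h').not_ge
    · rcases h with h | rfl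
      · exact (hg h).le
      · exact le_rfl
  refine containsCopy_of_map (F := F6) (fun s => Sum.elim g c (ofLex s)) ?_
  rintro (i | i) (j | j)
  · exact ⟨fun h => Sum.Lex.inl_le_inl_iff.2 ((hg' i j).1 h),
      fun h => (hg' i j).2 (Sum.Lex.inl_le_inl_iff.1 h)⟩
  · exact iff_of_true (hgc i j).le (Sum.Lex.inl_le_inr _ _)
  · exact iff_of_false (hgc j i).not_ge Sum.Lex.not_inr_le_inl
  · exact hc.le_iff_le.trans Sum.Lex.inr_le_inr_iff.symm

theorem containsCopy_F7 (a c : ℕ → P) (ha : ∀ i j, a i ≤ a j → i = j) (hc : StrictMono c)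
    (hac : ∀ j i, a j ≤ c i ↔ j + 1 ≤ i) (hca : ∀ i j, ¬ c i ≤ a j) : ContainsCopy F7 P := by
  refine containsCopy_of_map (F := F7) (Sum.elim a c) ?_
  rintro (i | i) (j | j)
  · exact ⟨fun h => ha i j h, fun h => le_of_eq (congrArg a h)⟩
  · exact hac i j
  · exact iff_of_false (hca i j) id
  · exact hc.le_iff_le

theorem containsCopy_F8 (a b : ℤ → P) (ha : ∀ i j, a i ≤ a j → i = j)
    (hb : ∀ i j, b i ≤ b j → i = j) (hab : ∀ i j, a i ≤ b j ↔ 0 < i ∨ j ≠ i)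
    (hba : ∀ i j, ¬ b i ≤ a j) : ContainsCopy F8 P := by
  refine containsCopy_of_map (F := F8) (Sum.elim a b) ?_
  rintro (i | i) (j | j)
  · exact ⟨fun h => ha i j h, fun h => le_of_eq (congrArg a h)⟩
  · exact hab i j
  · exact iff_of_false (hba i j) id
  · exact ⟨fun h => hb i j h, fun h => le_of_eq (congrArg b h)⟩

end Constructors

section Extraction

open Filter

theorem exists_strictMono_forall_lt_rel {R : ℕ → ℕ → Prop} (h : ∀ m, ∀ᶠ n in atTop, R m n) :
    ∃ φ : ℕ → ℕ, StrictMono φ ∧ ∀ m n, m < n → R (φ m) (φ n) := by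
  simp only [eventually_atTop] at h
  choose g hg using h
  let G : ℕ → ℕ := fun m => (Finset.range (m + 1)).sup g
  let φ : ℕ → ℕ := fun n => Nat.rec 0 (fun _ m => max (G m) (m + 1)) n
  have hφ : StrictMono φ := strictMono_nat_of_lt_succ fun n => le_max_right (G (φ n)) (φ n + 1)
  refine ⟨φ, hφ, fun m n hmn => hg _ _ ?_⟩
  calc g (φ m) ≤ G (φ m) := Finset.le_sup (by simp)
    _ ≤ φ (m + 1) := le_max_left _ _
    _ ≤ φ n := hφ.monotone hmn

theorem exists_strictMono_forall_ne_rel {Q : ℤ → ℤ → Prop} (h1 : ∀ n, {m | ¬ Q n m}.Finite)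
    (h2 : ∀ m, {n | ¬ Q n m}.Finite) (u : Bool → ℕ → ℤ) (hu : ∀ s k, k ≤ (u s k).natAbs) :
    ∃ φ : ℕ → ℕ, StrictMono φ ∧
      ∀ i j, i ≠ j → ∀ s t, Q (u s (φ i)) (u t (φ j)) ∧ u s (φ i) ≠ u t (φ j) := by
  have key : ∀ (S : Set ℤ), S.Finite → ∀ s, ∀ᶠ l in atTop, u s l ∉ S := by
    intro S hS s
    obtain ⟨B, hB⟩ := (hS.image Int.natAbs).bddAbove
    filter_upwards [eventually_gt_atTop B] with l hl hmem
    have h3 := hB (Set.mem_image_of_mem _ hmem)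
    have h4 := hu s l
    omega
  obtain ⟨φ, hφ, hR⟩ := exists_strictMono_forall_lt_rel
    (R := fun k l => ∀ s t, Q (u s k) (u t l) ∧ Q (u t l) (u s k) ∧ u s k ≠ u t l) (fun k => by
      rw [eventually_all]
      intro s
      rw [eventually_all]
      intro t
      filter_upwards [key _ (h1 (u s k)) t, key _ (h2 (u s k)) t,
        key _ (Set.finite_singleton (u s k)) t] with l ha hb hc
      exact ⟨not_not.1 ha, not_not.1 hb, fun h => hc h.symm⟩)
  refine ⟨φ, hφ, fun i j hij s t => ?_⟩
  rcases hij.lt_or_gt with hij | hij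
  · exact ⟨(hR i j hij s t).1, (hR i j hij s t).2.2⟩
  · exact ⟨(hR j i hij t s).2.1, (hR j i hij t s).2.2.symm⟩

variable {P : Type*} [PartialOrder P]

/-- An infinite antichain together with an `ω`-chain, none of whose elements lies below an element
of the antichain, contains `F₁`, `F₄` or `F₇`. -/
theorem containsForbidden_of_antichain_chain (a c : ℕ → P) (ha : ∀ i j, a i ≤ a j → i = j)
    (hc : StrictMono c) (hca : ∀ i j, ¬ c i ≤ a j) : ContainsForbidden P := by
  have lift : ∀ M, {i | a i ≤ c M}.Infinite → ContainsForbidden P := by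
    intro M hM
    let s := hM.natEmbedding
    refine Or.inr <| Or.inr <| Or.inr <| Or.inl <| containsCopy_F4 (fun i => a (s i))
      (fun j => c (M + 1 + j)) (fun i j h => ?_) (fun i j h => hc (by omega)) (fun i j => ?_)
    · exact s.injective (Subtype.ext (ha _ _ h))
    · exact lt_of_le_of_lt (s i).2 (hc (by omega))
  by_cases hS : {i | ∀ j, ¬ a i ≤ c j}.Infinite
  · let s := hS.natEmbedding
    exact Or.inl <| containsCopy_F1 (fun i => a (s i)) c
      (fun i j h => s.injective (Subtype.ext (ha _ _ h))) hc (fun i => (s i).2)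
      fun i j => hca _ _
  by_cases hT : ∃ M, {i | a i ≤ c M}.Infinite
  · obtain ⟨M, hM⟩ := hT
    exact lift M hM
  have step : ∀ m, ∃ i m', m < m' ∧ ¬ a i ≤ c m ∧ a i ≤ c m' := by
    intro m
    obtain ⟨i, hi⟩ := ((Set.not_infinite.1 hS).union
      (Set.not_infinite.1 fun h => hT ⟨m, h⟩)).exists_notMem
    simp only [Set.mem_union, Set.mem_ofPred_eq, not_or, not_forall, not_not] at hi
    obtain ⟨⟨j, hj⟩, hi⟩ := hi
    refine ⟨i, j, ?_, hi, hj⟩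
    by_contra! hle
    exact hi (hj.trans (hc.monotone hle))
  choose i s hs hi his using step
  let m : ℕ → ℕ := fun n => Nat.rec 0 (fun _ k => s k) n
  have hm : StrictMono m := strictMono_nat_of_lt_succ fun n => hs (m n)
  have hac : ∀ j k, a (i (m j)) ≤ c (m k) ↔ j + 1 ≤ k := by
    intro j k
    refine ⟨fun h => ?_, fun h => (his (m j)).trans (hc.monotone (hm.monotone h))⟩
    by_contra! hk
    exact hi (m j) (h.trans (hc.monotone (hm.monotone (Nat.lt_succ_iff.1 hk))))
  refine Or.inr <| Or.inr <| Or.inr <| Or.inr <| Or.inr <| Or.inr <| Or.inl <|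
    containsCopy_F7 (fun j => a (i (m j))) (fun k => c (m k)) (fun j k h => ?_) (hc.comp hm) hac
      (fun _ _ => hca _ _)
  have h' := ha _ _ h
  have h1 := hac j
  rw [h'] at h1
  have h2 := (h1 (k + 1)).1 ((hac k _).2 le_rfl)
  have h3 := (hac k (j + 1)).1 ((h1 _).2 le_rfl)
  omega

theorem containsForbidden_of_pairs_chain (p q c : ℕ → P) (hc : StrictMono c)
    (hpc : ∀ᶠ n in atTop, p n < c 0) (hqc : ∀ᶠ n in atTop, q n < c 0)
    (hpq : ∀ n, ¬ p n ≤ q n) (hqp : ∀ n, ¬ q n ≤ p n)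
    (hpp' : ∀ m, ∀ᶠ n in atTop, p n < p m) (hpq' : ∀ m, ∀ᶠ n in atTop, p n < q m)
    (hqp' : ∀ m, ∀ᶠ n in atTop, q n < p m) (hqq' : ∀ m, ∀ᶠ n in atTop, q n < q m) :
    ContainsForbidden P := by
  obtain ⟨φ, -, hφ⟩ := exists_strictMono_forall_lt_rel (fun m =>
    (hpp' m).and <| (hpq' m).and <| (hqp' m).and <| (hqq' m).and <| hpc.and hqc)
  have key : ∀ n, p (φ (n + 1)) < c 0 ∧ q (φ (n + 1)) < c 0 := fun n =>
    (hφ n (n + 1) n.lt_succ_self).2.2.2.2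
  refine Or.inr <| Or.inr <| Or.inr <| Or.inr <| Or.inr <| Or.inl <|
    containsCopy_F6 (fun n => p (φ (n + 1))) (fun n => q (φ (n + 1))) c hc
      (fun n j => (key n).1.trans_le (hc.monotone j.zero_le))
      (fun n j => (key n).2.trans_le (hc.monotone j.zero_le)) (fun n => hpq _) (fun n => hqp _) ?_
  intro m n hmn
  obtain ⟨h1, h2, h3, h4, -⟩ := hφ (m + 1) (n + 1) (by omega)
  exact ⟨h1, h2, h3, h4⟩

end Extraction

section Orbits

open Filter

variable {P : Type*} [PartialOrder P]

/-- Relations `x i < y j` between two `ℤ`-sequences persist under the forward shift. -/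
def ShiftLT (x y : ℤ → P) : Prop := ∀ i j, x i < y j → x (i + 1) < y (j + 1)

theorem ShiftLT.shift {x y : ℤ → P} (h : ShiftLT x y) {i j i' j' : ℤ} (hij : x i < y j)
    (hi : i ≤ i') (hj : j' = j + (i' - i)) : x i' < y j' := by
  subst hj
  induction i', hi using Int.leInduction with
  | base => simpa using hij
  | succ n _ ih =>
    have := h _ _ ih
    rwa [show j + (n + 1 - i) = j + (n - i) + 1 by ring]

theorem lt_of_forall_lt_succ {x : ℤ → P} {m : ℤ} (h : ∀ n, m ≤ n → x n < x (n + 1)) {i j : ℤ}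
    (hi : m ≤ i) (hij : i < j) : x i < x j := by
  have hij' : i + 1 ≤ j := hij
  induction j, hij' using Int.leInduction with
  | base => exact h i hi
  | succ n hn ih => exact (ih (by omega)).trans (h n (by omega))

/-- An injective orbit on which consecutive elements become comparable only after some moment. -/
theorem containsForbidden_of_single_orbit (z : ℤ → P) (sh : ShiftLT z z)
    (inj : Function.Injective z)
    (hneg : ∀ n ≤ 0, ¬ z n < z (n + 1)) (hpos : ∀ n ≥ 1, z n < z (n + 1)) :
    ContainsForbidden P := by
  have mono : ∀ {i j : ℤ}, 1 ≤ i → i < j → z i < z j := fun hi hij =>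
    lt_of_forall_lt_succ hpos hi hij
  have idx_lt : ∀ {i j : ℤ}, z i < z j → i < j := by
    intro i j h
    by_contra! hji
    have h1 := sh.shift (i' := i + (|j| + 1)) (j' := j + (|j| + 1)) h
      (by have := abs_nonneg j; omega) (by ring)
    rcases hji.eq_or_lt with rfl | hji
    · exact lt_irrefl _ h1
    · have := neg_abs_le j
      exact (mono (by omega) (by omega)).asymm h1
  have idx_le : ∀ {i j : ℤ}, z i ≤ z j → i ≤ j := by
    intro i j h
    rcases h.eq_or_lt with h | h
    · exact (inj h).le
    · exact (idx_lt h).le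
  have hcmono : StrictMono fun j : ℕ => z (1 + j) := fun i j hij => mono (by omega) (by omega)
  by_cases hall : ∀ N : ℤ, ∀ᶠ n : ℕ in atTop, z (-n) < z N
  · have hsucc : ∀ N : ℤ, ∀ᶠ n : ℕ in atTop, z (-n - 1) < z N := by
      intro N
      filter_upwards [(tendsto_add_atTop_nat 1).eventually (hall N)] with n hn
      simpa [sub_eq_add_neg, add_comm] using hn
    refine containsForbidden_of_pairs_chain (fun n : ℕ => z (-n)) (fun n : ℕ => z (-n - 1))
      (fun j : ℕ => z (1 + j)) hcmono (hall _) (hsucc _) (fun n h => ?_) (fun n h => ?_)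
      (fun m => hall _) (fun m => hall _) (fun m => hsucc _) (fun m => hsucc _)
    · have := idx_le h
      omega
    · refine hneg (-n - 1) (by omega) (lt_of_le_of_ne ?_ fun h' => ?_)
      · simpa using h
      · have := inj h'
        omega
  push Not at hall
  obtain ⟨N, hN⟩ := hall
  by_cases hfree : ∃ n, ∀ j : ℕ, ¬ z n < z (1 + j)
  · obtain ⟨n, hn⟩ := hfree
    refine containsForbidden_of_antichain_chain (fun i : ℕ => z (min n 0 - i))
      (fun j : ℕ => z (1 + j)) (fun i j h => ?_) hcmono (fun i j h => ?_)
    · by_contra hij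
      have hlt : z (min n 0 - i) < z (min n 0 - j) := lt_of_le_of_ne h fun h' => by
        have := inj h'
        omega
      have hji := idx_lt hlt
      set k : ℤ := i - j with hk
      have hk0 : 1 ≤ k := by omega
      let w : ℤ → P := fun t => z (n + k * t)
      have hw : ∀ t : ℤ, 0 ≤ t → w t < w (t + 1) := fun t ht => by
        refine sh.shift hlt ?_ ?_
        · have : 0 ≤ k * t := by positivity
          omega
        · simp only [hk]; ring
      have h1 : w 0 < w (|n| + 1) :=
        lt_of_forall_lt_succ hw le_rfl (by have := abs_nonneg n; omega)
      have h2 : 1 ≤ n + k * (|n| + 1) := by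
        have := neg_abs_le n
        have := abs_nonneg n
        nlinarith
      refine hn (n + k * (|n| + 1) - 1).toNat ?_
      have h3 : 1 + ((n + k * (|n| + 1) - 1).toNat : ℤ) = n + k * (|n| + 1) := by omega
      rw [h3]
      simpa [w] using h1
    · have := idx_le h
      omega
  push Not at hfree
  obtain ⟨φ, hφ, hφN⟩ := extraction_of_frequently_atTop
    ((hN.and_eventually (eventually_gt_atTop (-N).toNat)))
  obtain ⟨g, hg⟩ := exists_increasing_or_nonincreasing_subseq (· > ·) fun n : ℕ => z (-(φ n))
  have hgφ : StrictMono fun n => φ (g n) := hφ.comp g.strictMono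
  rcases hg with hg | hg
  · obtain ⟨a, ha⟩ := hfree N
    obtain ⟨b, hb⟩ := hfree (-(φ (g 0)))
    have hanti : StrictAnti fun n => z (-(φ (g n))) := fun m n hmn => hg m n hmn
    refine Or.inr <| Or.inr <| Or.inr <| Or.inr <| Or.inl <| containsCopy_F5 (z N)
      (fun n => z (-(φ (g n)))) (fun j : ℕ => z (1 + (a + b + j : ℕ))) hanti
      (fun i j hij => hcmono (by omega)) (fun j => ?_) (fun i j => ?_) (fun i h => ?_)
      (fun i h => ?_)
    · exact ha.trans_le (hcmono.monotone (by omega))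
    · exact (hanti.antitone i.zero_le).trans_lt (hb.trans_le (hcmono.monotone (by omega)))
    · have h1 := idx_le h
      have h2 := (hφN (g i)).2
      omega
    · have h2 := (hφN (g i)).2
      refine (hφN (g i)).1 (lt_of_le_of_ne h fun h' => ?_)
      have := inj h'
      omega
  · refine containsForbidden_of_antichain_chain (fun n => z (-(φ (g n)))) (fun j : ℕ => z (1 + j))
      (fun i j h => ?_) hcmono (fun i j h => ?_)
    · by_contra hij
      have h1 := idx_le h
      have h2 : j ≤ i := hgφ.le_iff_le.1 (by omega)
      refine hg j i (by omega) (lt_of_le_of_ne h fun h' => hij ?_)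
      have := inj h'
      exact hgφ.injective (by omega)
    · have := idx_le h
      omega

/-- Two orbits `x` and `y` such that `x n < y n` holds exactly for positive `n`. -/
structure SplitPair (x y : ℤ → P) : Prop where
  shift_xy : ShiftLT x y
  shift_yx : ShiftLT y x
  ne : ∀ i j, x i ≠ y j
  neg : ∀ n ≤ 0, ¬ x n < y n
  pos : ∀ n ≥ 1, x n < y n

namespace SplitPair

variable {x y : ℤ → P}

theorem dual (h : SplitPair x y) :
    SplitPair (P := Pᵒᵈ) (fun n => OrderDual.toDual (y n)) (fun n => OrderDual.toDual (x n)) where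
  shift_xy i j hij := h.shift_xy j i hij
  shift_yx i j hij := h.shift_yx j i hij
  ne i j hij := h.ne j i hij.symm
  neg n hn := h.neg n hn
  pos n hn := h.pos n hn

theorem lt_of_le (h : SplitPair x y) {i j : ℤ} (hij : x i ≤ y j) : x i < y j :=
  lt_of_le_of_ne hij (h.ne i j)

theorem gt_of_ge (h : SplitPair x y) {i j : ℤ} (hij : y i ≤ x j) : y i < x j :=
  lt_of_le_of_ne hij (h.ne j i).symm

theorem not_ge (h : SplitPair x y) (n : ℤ) : ¬ y n ≤ x n := by
  intro hn
  have := le_max_left n 1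
  have h1 := h.shift_yx.shift (i' := max n 1) (j' := max n 1) (h.gt_of_ge hn) this (by ring)
  exact h1.asymm (h.pos _ (le_max_right _ _))

theorem not_le (h : SplitPair x y) {n : ℤ} (hn : n ≤ 0) : ¬ x n ≤ y n := fun hle =>
  h.neg n hn (h.lt_of_le hle)

theorem not_ge_of_antichain (h : SplitPair x y) (hx : ∀ i j, x i ≤ x j → i = j) (i j : ℤ) :
    ¬ y i ≤ x j := by
  intro hij
  have h1 := h.shift_yx.shift (i' := max i 1) (j' := j + (max i 1 - i)) (h.gt_of_ge hij)
    (le_max_left _ _) rfl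
  have h2 := (h.pos _ (le_max_right i 1)).trans h1
  rw [← hx _ _ h2.le] at h2
  exact lt_irrefl _ h2

theorem not_monotone_antitone (h : SplitPair x y) (hx : Monotone x) (hy : Antitone y) : False :=
  h.neg 0 le_rfl <| ((hx zero_le_one).trans_lt (h.pos 1 le_rfl)).trans_le (hy zero_le_one)

theorem containsForbidden_const_antichain (h : SplitPair x y) (hx : ∀ i j, x i = x j)
    (hy : ∀ i j, y i ≤ y j → i = j) : ContainsForbidden P := by
  refine Or.inr <| Or.inl <| containsCopy_F2 (x 0) (fun i : ℕ => y (1 + i)) (fun i : ℕ => y (-i))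
    (fun i => ?_) (fun i j hij => ?_) (fun i j hij => ?_) (fun i j hij => ?_) (fun i j hij => ?_)
    (fun i hi => ?_) (fun i hi => ?_)
  · rw [hx 0 (1 + i)]
    exact h.pos _ (by omega)
  · have := hy _ _ hij
    omega
  · have := hy _ _ hij
    omega
  · have := hy _ _ hij
    omega
  · have := hy _ _ hij
    omega
  · rw [hx 0 (-i)] at hi
    exact h.not_le (by omega) hi
  · rw [hx 0 (-i)] at hi
    exact h.not_ge _ hi

theorem containsForbidden_const_strictMono (h : SplitPair x y) (hx : ∀ i j, x i = x j)
    (hy : StrictMono y) : ContainsForbidden P := by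
  refine Or.inr <| Or.inr <| Or.inr <| Or.inr <| Or.inl <| containsCopy_F5 (x 0)
    (fun i : ℕ => y (-i)) (fun i : ℕ => y (1 + i)) (fun i j hij => hy (by omega))
    (fun i j hij => hy (by omega)) (fun i => ?_) (fun i j => hy (by omega)) (fun i hi => ?_)
    (fun i hi => ?_)
  · rw [hx 0 (1 + i)]
    exact h.pos _ (by omega)
  · rw [hx 0 (-i)] at hi
    exact h.not_le (by omega) hi
  · rw [hx 0 (-i)] at hi
    exact h.not_ge _ hi

theorem containsForbidden_strictMono_strictMono (h : SplitPair x y) (hx : StrictMono x)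
    (hy : StrictMono y) : ContainsForbidden P := by
  have hc : StrictMono fun j : ℕ => y (1 + j) := fun i j hij => hy (by omega)
  have hcx : ∀ j : ℕ, x j.succ < y (1 + j) := fun j => by
    rw [Nat.cast_succ, add_comm]
    exact h.pos _ (by omega)
  have key : ∀ {z w : ℤ → P}, StrictMono z → ∀ N, (∃ m : ℤ, z m < w N) →
      ∀ᶠ n : ℕ in atTop, z (-n) < w N := by
    rintro z w hz N ⟨m, hm⟩
    filter_upwards [eventually_ge_atTop (-m).toNat] with n hn
    exact (hz.monotone (by omega)).trans_lt hm
  by_cases h1 : ∃ N, ∀ m, ¬ x m < y N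
  · obtain ⟨N, hN⟩ := h1
    refine Or.inr <| Or.inr <| Or.inr <| Or.inr <| Or.inl <| containsCopy_F5 (y N)
      (fun i : ℕ => x (N - i)) (fun j : ℕ => y (1 + (N.toNat + j : ℕ)))
      (fun i j hij => hx (by omega)) (fun i j hij => hy (by omega)) (fun i => hy (by omega))
      (fun i j => ?_) (fun i hi => ?_) (fun i hi => ?_)
    · exact (hx (by omega)).trans (hcx _)
    · exact h.not_ge N (hi.trans (hx.monotone (by omega)))
    · exact hN _ (h.lt_of_le hi)
  by_cases h2 : ∃ N, ∀ m, ¬ y m < x N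
  · obtain ⟨N, hN⟩ := h2
    refine Or.inr <| Or.inr <| Or.inr <| Or.inr <| Or.inl <| containsCopy_F5 (x (min N 0))
      (fun i : ℕ => y (min N 0 - i)) (fun j : ℕ => y (1 + j))
      (fun i j hij => hy (by omega)) hc (fun i => ?_) (fun i j => hy (by omega))
      (fun i hi => ?_) (fun i hi => ?_)
    · exact (hx (by omega)).trans (hcx _)
    · exact h.not_le (min_le_right N 0) (hi.trans (hy.monotone (by omega)))
    · exact hN _ ((h.gt_of_ge hi).trans_le (hx.monotone (min_le_left _ _)))
  push Not at h1 h2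
  exact containsForbidden_of_pairs_chain (fun n : ℕ => x (-n)) (fun n : ℕ => y (-n))
    (fun j : ℕ => y (1 + j)) hc (key hx _ (h1 _)) (key hy _ ⟨0, hy (by omega)⟩)
    (fun n => h.not_le (by omega)) (fun n => h.not_ge _)
    (fun m => key hx _ ⟨-m - 1, hx (by omega)⟩) (fun m => key hx _ (h1 _))
    (fun m => key hy _ (h2 _)) (fun m => key hy _ ⟨-m - 1, hy (by omega)⟩)

theorem containsForbidden_dual_strictMono_antichain (h : SplitPair x y) (hx : StrictMono x)
    (hy : ∀ i j, y i ≤ y j → i = j) : ContainsForbidden Pᵒᵈ := by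
  refine Or.inr <| Or.inr <| Or.inr <| Or.inl <| containsCopy_F4 (P := Pᵒᵈ)
    (fun i : ℕ => OrderDual.toDual (y (1 + i))) (fun j : ℕ => OrderDual.toDual (x (-j)))
    (fun i j hij => ?_) (fun i j hij => ?_) (fun i j => ?_)
  · have := hy _ _ hij
    omega
  · exact hx (show -(j : ℤ) < -i by omega)
  · exact (hx (show -(j : ℤ) < 1 + i by omega)).trans (h.pos _ (by omega))

theorem containsForbidden_antichain_strictMono (h : SplitPair x y)
    (hx : ∀ i j, x i ≤ x j → i = j) (hy : StrictMono y) : ContainsForbidden P :=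
  containsForbidden_of_antichain_chain (fun i : ℕ => x i) (fun j : ℕ => y j)
    (fun i j hij => by simpa using hx _ _ hij) (fun i j hij => hy (by omega))
    (fun i j => h.not_ge_of_antichain hx _ _)

theorem not_ge_of_strictAnti_strictMono (h : SplitPair x y) (hx : StrictAnti x)
    (hy : StrictMono y) (i j : ℤ) : ¬ y i ≤ x j := by
  intro hij
  have h1 := h.shift_yx.shift (i' := i + (|i| + |j| + 1)) (j' := j + (|i| + |j| + 1))
    (h.gt_of_ge hij) (by have := abs_nonneg i; have := abs_nonneg j; omega) (by ring)
  have hi := neg_abs_le i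
  have hj := neg_abs_le j
  have hi' := abs_nonneg i
  have hj' := abs_nonneg j
  refine lt_asymm h1 ?_
  rcases le_total i j with hle | hle
  · exact (hx.antitone (by omega)).trans_lt (h.pos (i + (|i| + |j| + 1)) (by omega))
  · exact (h.pos (j + (|i| + |j| + 1)) (by omega)).trans_le (hy.monotone (by omega))

theorem containsForbidden_strictAnti_strictMono_of_lt (h : SplitPair x y)
    (hx : StrictAnti x) (hy : StrictMono y) {d m : ℤ} (hd : x d < y m) (hd0 : ¬ x d < y 0) :
    ContainsForbidden P := by
  refine Or.inr <| Or.inr <| Or.inr <| Or.inr <| Or.inl <| containsCopy_F5 (x d)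
    (fun i : ℕ => y (-i)) (fun j : ℕ => y (m.toNat + 1 + j)) (fun i j hij => hy (by omega))
    (fun i j hij => hy (by omega)) (fun i => hd.trans (hy (by omega))) (fun i j => hy (by omega))
    (fun i hi => ?_) (fun i hi => h.not_ge_of_strictAnti_strictMono hx hy _ _ hi)
  exact hd0 ((h.lt_of_le hi).trans_le (hy.monotone (by omega)))

theorem containsForbiddenOrDual_strictAnti_strictMono (h : SplitPair x y) (hx : StrictAnti x)
    (hy : StrictMono y) : ContainsForbiddenOrDual P := by
  by_cases h1 : x 1 < y 0
  · exact Or.inr <| h.dual.containsForbidden_strictAnti_strictMono_of_lt (fun i j hij => hy hij)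
      (fun i j hij => hx hij) (d := 0) (m := 1) h1 (h.neg 0 le_rfl)
  · exact Or.inl <| h.containsForbidden_strictAnti_strictMono_of_lt hx hy (h.pos 1 le_rfl) h1

theorem containsForbidden_antichains_of_infinite (h : SplitPair x y)
    (hx : ∀ i j, x i ≤ x j → i = j) (hy : ∀ i j, y i ≤ y j → i = j) {n : ℤ}
    (h1 : {m | x n < y m}.Infinite) (h2 : {m | ¬ x n < y m}.Infinite) : ContainsForbidden P := by
  let s := h1.natEmbedding
  let t := h2.natEmbedding
  have hst : ∀ i j, (s i : ℤ) ≠ t j := fun i j hij => (t j).2 (hij ▸ (s i).2)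
  exact Or.inr <| Or.inl <| containsCopy_F2 (x n) (fun i => y (s i)) (fun i => y (t i))
    (fun i => (s i).2) (fun i j hij => s.injective (Subtype.ext (hy _ _ hij)))
    (fun i j hij => t.injective (Subtype.ext (hy _ _ hij)))
    (fun i j hij => hst _ _ (hy _ _ hij)) (fun i j hij => hst _ _ (hy _ _ hij).symm)
    (fun i hi => (t i).2 (h.lt_of_le hi)) (fun i => h.not_ge_of_antichain hx _ _)

theorem infinite_not_lt_of_finite (h : SplitPair x y) {n : ℤ} (hn : {m | x n < y m}.Finite)
    (m : ℤ) : {k | ¬ x k < y m}.Infinite := by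
  obtain ⟨M, hM⟩ := hn.bddAbove
  refine Set.infinite_of_injective_forall_mem (f := fun j : ℕ => n - (j + (M - m).toNat + 1))
    (fun i j hij => by simpa using hij) fun j hj => ?_
  have h1 : m + (j + (M - m).toNat + 1) ≤ M := hM <| h.shift_xy.shift hj (by omega) (by ring)
  omega

theorem containsForbidden_antichains_of_finite (h : SplitPair x y)
    (hx : ∀ i j, x i ≤ x j → i = j) (hy : ∀ i j, y i ≤ y j → i = j)
    (h1 : ∀ n, {m | x n < y m}.Finite) (h2 : ∀ m, {n | x n < y m}.Finite) :
    ContainsForbidden P := by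
  have hyx := h.not_ge_of_antichain hx
  have hg : ∀ k : ℕ, ∃ g : ℕ, k ≤ g ∧ ¬ x (k + 1) < y (-g) := by
    intro k
    obtain ⟨B, hB⟩ := (h1 (k + 1)).bddBelow
    refine ⟨max k (-B + 1).toNat, le_max_left _ _, fun hlt => ?_⟩
    have := hB hlt
    omega
  choose g hkg hg using hg
  obtain ⟨φ, hφ, hR⟩ := exists_strictMono_forall_ne_rel (Q := fun n m => ¬ x n < y m)
    (by simpa using h1) (by simpa using h2) (fun s k => bif s then (k + 1 : ℤ) else -g k)
    (fun s k => by
      have := hkg k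
      cases s <;> simp only [cond_true, cond_false] <;> omega)
  refine Or.inr <| Or.inr <| Or.inl <| containsCopy_F3 (fun i => y (-g (φ i)))
    (fun i => x (φ i + 1)) (fun i => y (φ i + 1)) (fun i j hij => ?_) (fun i j hij => ?_)
    (fun i j hij => ?_) (fun i j => ⟨fun hij => ?_, fun hij => ?_⟩) (fun i j => hyx _ _)
    (fun i j => hyx _ _) (fun i j hij => ?_) (fun i j hij => ?_) (fun i j hij => ?_)
  · by_contra hne
    exact (hR i j hne false false).2 (hy _ _ hij)
  · have := hx _ _ hij
    exact hφ.injective (by omega)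
  · have := hy _ _ hij
    exact hφ.injective (by omega)
  · by_contra hne
    exact (hR i j hne true true).1 (h.lt_of_le hij)
  · subst hij
    exact (h.pos _ (by omega)).le
  · rcases eq_or_ne i j with rfl | hne
    · exact hg _ (h.lt_of_le hij)
    · exact (hR i j hne true false).1 (h.lt_of_le hij)
  · have := hy _ _ hij
    omega
  · have := hy _ _ hij
    omega

theorem containsForbidden_antichains_of_cofinite (h : SplitPair x y)
    (hx : ∀ i j, x i ≤ x j → i = j) (hy : ∀ i j, y i ≤ y j → i = j)
    (h1 : ∀ n, {m | ¬ x n < y m}.Finite) (h2 : ∀ m, {n | ¬ x n < y m}.Finite) :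
    ContainsForbidden P := by
  have hyx := h.not_ge_of_antichain hx
  have hg : ∀ k : ℕ, ∃ g : ℕ, k + 1 ≤ g ∧ x g < y (-k) ∧ x (-k) < y g := by
    intro k
    obtain ⟨B, hB⟩ := ((h1 (-k)).union (h2 (-k))).bddAbove
    have hmem : ((max (k + 1) (B + 1).toNat : ℕ) : ℤ) ∉
        {m | ¬ x (-k) < y m} ∪ {n | ¬ x n < y (-k)} := fun hmem => by
      have := hB hmem
      omega
    simp only [Set.mem_union, Set.mem_ofPred_eq, not_or, not_not] at hmem
    exact ⟨_, le_max_left _ _, hmem.2, hmem.1⟩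
  choose g hkg hg1 hg2 using hg
  let u : Bool → ℕ → ℤ := fun s k => bif s then (g k : ℤ) else -k
  obtain ⟨φ, hφ, hR⟩ := exists_strictMono_forall_ne_rel (Q := fun n m => x n < y m) h1 h2 u
    (fun s k => by
      have := hkg k
      cases s <;> simp only [u, cond_true, cond_false] <;> omega)
  let κ : ℤ → ℕ := fun i => if 0 < i then i.toNat - 1 else (-i).toNat
  let ψ : ℤ → ℤ := fun i => u (decide (0 < i)) (φ (κ i))
  have hψ_pos : ∀ i, 0 < i → ψ i = g (φ (κ i)) := fun i hi => by simp [ψ, u, hi]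
  have hψ_neg : ∀ i, i ≤ 0 → ψ i = -φ (κ i) := fun i hi => by simp [ψ, u, hi.not_gt]
  have hκ : ∀ i j, κ i = κ j → i ≠ j → (0 < i ∧ j ≤ 0) ∨ (0 < j ∧ i ≤ 0) := by
    intro i j hij hne
    simp only [κ] at hij
    split_ifs at hij <;> omega
  have hinj : ∀ i j, ψ i = ψ j → i = j := by
    intro i j hij
    by_contra hne
    by_cases hk : κ i = κ j
    · have h3 := hkg (φ (κ i))
      have h4 := hkg (φ (κ j))
      rcases hκ i j hk hne with ⟨hi, hj⟩ | ⟨hj, hi⟩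
      · rw [hψ_pos i hi, hψ_neg j hj] at hij
        omega
      · rw [hψ_pos j hj, hψ_neg i hi] at hij
        omega
    · exact (hR _ _ hk _ _).2 hij
  refine Or.inr <| Or.inr <| Or.inr <| Or.inr <| Or.inr <| Or.inr <| Or.inr <|
    containsCopy_F8 (fun i => x (ψ i)) (fun i => y (ψ i)) (fun i j hij => hinj _ _ (hx _ _ hij))
    (fun i j hij => hinj _ _ (hy _ _ hij)) (fun i j => ?_) (fun i j => hyx _ _)
  rcases eq_or_ne j i with rfl | hne
  · rcases lt_or_ge 0 j with hj | hj
    · refine iff_of_true (h.pos _ ?_).le (Or.inl hj)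
      have := hkg (φ (κ j))
      rw [hψ_pos j hj]
      omega
    · refine iff_of_false (h.not_le ?_) (by omega)
      rw [hψ_neg j hj]
      omega
  · refine iff_of_true (le_of_lt ?_) (Or.inr hne)
    by_cases hk : κ i = κ j
    · rcases hκ i j hk hne.symm with ⟨hi, hj⟩ | ⟨hj, hi⟩
      · rw [hψ_pos i hi, hψ_neg j hj, hk]
        exact hg1 _
      · rw [hψ_pos j hj, hψ_neg i hi, hk]
        exact hg2 _
    · exact (hR _ _ hk _ _).1

theorem containsForbiddenOrDual_antichains (h : SplitPair x y)
    (hx : ∀ i j, x i ≤ x j → i = j) (hy : ∀ i j, y i ≤ y j → i = j) :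
    ContainsForbiddenOrDual P := by
  by_cases hrow : ∃ n, {m | x n < y m}.Infinite ∧ {m | ¬ x n < y m}.Infinite
  · obtain ⟨n, h1, h2⟩ := hrow
    exact Or.inl <| h.containsForbidden_antichains_of_infinite hx hy h1 h2
  by_cases hcol : ∃ m, {n | x n < y m}.Infinite ∧ {n | ¬ x n < y m}.Infinite
  · obtain ⟨m, h1, h2⟩ := hcol
    exact Or.inr <| h.dual.containsForbidden_antichains_of_infinite
      (fun i j hij => (hy j i hij).symm) (fun i j hij => (hx j i hij).symm) h1 h2
  simp only [not_exists, not_and, Set.not_infinite] at hrow hcol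
  have row_fin : ∀ n, {m | ¬ x n < y m}.Infinite → {m | x n < y m}.Finite := fun n hn => by
    by_contra hinf
    exact hn (hrow n hinf)
  have col_fin : ∀ m, {n | ¬ x n < y m}.Infinite → {n | x n < y m}.Finite := fun m hm => by
    by_contra hinf
    exact hm (hcol m hinf)
  have row_col : ∀ n, {m | x n < y m}.Finite → ∀ m, {n | x n < y m}.Finite := fun n hn m =>
    col_fin m (h.infinite_not_lt_of_finite hn m)
  have col_row : ∀ m, {n | x n < y m}.Finite → ∀ n, {m | x n < y m}.Finite := fun m hm n =>
    row_fin n (h.dual.infinite_not_lt_of_finite (n := m) hm n)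
  by_cases hfin : ∃ n, {m | x n < y m}.Finite
  · obtain ⟨n, hn⟩ := hfin
    exact Or.inl <| h.containsForbidden_antichains_of_finite hx hy
      (col_row 0 (row_col n hn 0)) (row_col n hn)
  · push Not at hfin
    refine Or.inl <| h.containsForbidden_antichains_of_cofinite hx hy (fun n => hrow n (hfin n))
      (fun m => hcol m fun hm => hfin 0 (col_row m hm 0))

end SplitPair

/-- The possible shapes of an orbit on which the shift is an automorphism. -/
def IsPureOrbit (x : ℤ → P) : Prop :=
  (∀ i j, x i = x j) ∨ (∀ i j, x i ≤ x j → i = j) ∨ StrictMono x ∨ StrictAnti x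

theorem IsPureOrbit.comp_mul {x : ℤ → P} {p : ℕ} (h : IsPureOrbit fun n => x (p * n)) {q : ℕ}
    (hq : 0 < q) : IsPureOrbit fun n => x ((p * q : ℕ) * n) := by
  have hq' : (0 : ℤ) < q := by exact_mod_cast hq
  have hmono : StrictMono fun n : ℤ => (q : ℤ) * n := fun i j hij =>
    mul_lt_mul_of_pos_left hij hq'
  have heq : (fun n => x ((p * q : ℕ) * n)) = (fun n => x (p * n)) ∘ fun n : ℤ => (q : ℤ) * n := by
    funext n
    simp [mul_assoc]
  rw [heq]
  rcases h with h | h | h | h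
  · exact Or.inl fun i j => h _ _
  · exact Or.inr <| Or.inl fun i j hij => hmono.injective (h _ _ hij)
  · exact Or.inr <| Or.inr <| Or.inl <| h.comp hmono
  · exact Or.inr <| Or.inr <| Or.inr <| h.comp_strictMono hmono

theorem SplitPair.containsForbiddenOrDual {x y : ℤ → P} (h : SplitPair x y) (hx : IsPureOrbit x)
    (hy : IsPureOrbit y) : ContainsForbiddenOrDual P := by
  have mono_of_const : ∀ {z : ℤ → P}, (∀ i j, z i = z j) → Monotone z := fun hz i j _ =>
    (hz i j).le
  have anti_of_const : ∀ {z : ℤ → P}, (∀ i j, z i = z j) → Antitone z := fun hz i j _ =>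
    (hz j i).le
  rcases hx with hx | hx | hx | hx <;> rcases hy with hy | hy | hy | hy
  · exact (h.not_monotone_antitone (mono_of_const hx) (anti_of_const hy)).elim
  · exact Or.inl <| h.containsForbidden_const_antichain hx hy
  · exact Or.inl <| h.containsForbidden_const_strictMono hx hy
  · exact (h.not_monotone_antitone (mono_of_const hx) hy.antitone).elim
  · exact Or.inr <| h.dual.containsForbidden_const_antichain hy fun i j hij => (hx j i hij).symm
  · exact h.containsForbiddenOrDual_antichains hx hy
  · exact Or.inl <| h.containsForbidden_antichain_strictMono hx hy
  · exact Or.inl <| h.dual.containsForbidden_dual_strictMono_antichain (fun i j hij => hy hij)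
      fun i j hij => (hx j i hij).symm
  · exact (h.not_monotone_antitone hx.monotone (anti_of_const hy)).elim
  · exact Or.inr <| h.containsForbidden_dual_strictMono_antichain hx hy
  · exact Or.inl <| h.containsForbidden_strictMono_strictMono hx hy
  · exact (h.not_monotone_antitone hx.monotone hy.antitone).elim
  · exact Or.inr <| h.dual.containsForbidden_const_strictMono hy fun i j hij => hx hij
  · exact Or.inr <| h.dual.containsForbidden_antichain_strictMono
      (fun i j hij => (hy j i hij).symm) fun i j hij => hx hij
  · exact h.containsForbiddenOrDual_strictAnti_strictMono hx hy
  · exact Or.inr <| h.dual.containsForbidden_strictMono_strictMono (fun i j hij => hy hij)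
      fun i j hij => hx hij

theorem containsForbidden_of_irregular_orbit_of_lt (o : ℤ → P) (sh : ShiftLT o o)
    (eqsh : ∀ i j n, o i = o j → o (i + n) = o (j + n)) {i j : ℤ} (hij : i < j)
    (h0 : ¬ o i < o j) (h1 : o (i + 1) < o (j + 1)) : ContainsForbidden P := by
  have hpos : ∀ n : ℤ, 1 ≤ n → o (i + (j - i) * n) < o (i + (j - i) * (n + 1)) := by
    intro n hn
    refine sh.shift h1 ?_ (by ring)
    nlinarith
  refine containsForbidden_of_single_orbit (fun n => o (i + (j - i) * n)) ?_ ?_ ?_ hpos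
  · intro a b hab
    exact sh.shift hab (by nlinarith) (by ring)
  · refine Function.Injective.of_lt_imp_ne fun a b hab heq => ?_
    have h2 := eqsh _ _ ((j - i) * (1 - a)) heq
    have h3 := lt_of_forall_lt_succ hpos le_rfl (show 1 < b - a + 1 by omega)
    refine h3.ne ?_
    convert h2 using 2 <;> ring
  · intro n hn hlt
    refine h0 (sh.shift hlt ?_ (by ring))
    nlinarith

theorem containsForbiddenOrDual_of_irregular_orbit (o : ℤ → P) (sh : ShiftLT o o)
    (eqsh : ∀ i j n, o i = o j → o (i + n) = o (j + n)) {i j : ℤ}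
    (h0 : ¬ o i < o j) (h1 : o (i + 1) < o (j + 1)) : ContainsForbiddenOrDual P := by
  rcases lt_trichotomy i j with hij | rfl | hij
  · exact Or.inl <| containsForbidden_of_irregular_orbit_of_lt o sh eqsh hij h0 h1
  · exact (lt_irrefl _ h1).elim
  · exact Or.inr <| containsForbidden_of_irregular_orbit_of_lt (P := Pᵒᵈ)
      (fun n => OrderDual.toDual (o n)) (fun a b hab => sh b a hab) eqsh hij h0 h1

theorem exists_isPureOrbit (o : ℤ → P) (sh : ShiftLT o o)
    (eqsh : ∀ i j n, o i = o j → o (i + n) = o (j + n))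
    (reg : ∀ i j, o (i + 1) < o (j + 1) → o i < o j) :
    ∃ p : ℕ, 0 < p ∧ IsPureOrbit fun n => o (p * n) := by
  have back : ∀ (n : ℕ) (i j : ℤ), o (i + n) < o (j + n) → o i < o j := by
    intro n
    induction n with
    | zero => simp
    | succ n ih =>
      intro i j hij
      refine ih i j (reg _ _ ?_)
      simpa [add_assoc] using hij
  have sh' : ∀ (n i j : ℤ), o i < o j → o (i + n) < o (j + n) := by
    intro n i j hij
    rcases le_total 0 n with hn | hn
    · exact sh.shift hij (by omega) (by ring)
    · obtain ⟨m, hm⟩ := Int.eq_ofNat_of_zero_le (neg_nonneg.2 hn)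
      refine back m _ _ ?_
      rwa [← hm, add_neg_cancel_right, add_neg_cancel_right]
  by_cases hper : ∃ p : ℕ, 0 < p ∧ o p = o 0
  · obtain ⟨p, hp, hp0⟩ := hper
    refine ⟨p, hp, Or.inl ?_⟩
    have hstep : ∀ n : ℤ, o (p * (n + 1)) = o (p * n) := fun n => by
      have := eqsh _ _ (p * n) hp0
      rwa [zero_add, show (p : ℤ) + p * n = p * (n + 1) by ring] at this
    have hzero : ∀ n : ℤ, o (p * n) = o (p * 0) := fun n => by
      induction n using Int.induction_on with
      | zero => rfl
      | succ n ih => rw [hstep, ih]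
      | pred n ih => rw [← ih, ← hstep (-n - 1), sub_add_cancel]
    exact fun i j => (hzero i).trans (hzero j).symm
  by_cases hup : ∃ p : ℕ, 0 < p ∧ o 0 < o p
  · obtain ⟨p, hp, hp0⟩ := hup
    refine ⟨p, hp, Or.inr <| Or.inr <| Or.inl <| strictMono_int_of_lt_succ fun n => ?_⟩
    have := sh' (p * n) _ _ hp0
    rwa [zero_add, show (p : ℤ) + p * n = p * (n + 1) by ring] at this
  by_cases hdown : ∃ p : ℕ, 0 < p ∧ o p < o 0
  · obtain ⟨p, hp, hp0⟩ := hdown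
    refine ⟨p, hp, Or.inr <| Or.inr <| Or.inr <| strictAnti_int_of_succ_lt fun n => ?_⟩
    have := sh' (p * n) _ _ hp0
    rwa [zero_add, show (p : ℤ) + p * n = p * (n + 1) by ring] at this
  refine ⟨1, one_pos, Or.inr <| Or.inl fun i j hij => ?_⟩
  simp only [Nat.cast_one, one_mul] at hij
  by_contra hne
  rcases hij.eq_or_lt with hij | hij
  · rcases Ne.lt_or_gt hne with hlt | hlt
    · refine hper ⟨(j - i).toNat, by omega, ?_⟩
      have := eqsh _ _ (-i) hij
      rw [Int.toNat_of_nonneg (by omega), sub_eq_add_neg, ← this, add_neg_cancel]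
    · refine hper ⟨(i - j).toNat, by omega, ?_⟩
      have := eqsh _ _ (-j) hij
      rw [Int.toNat_of_nonneg (by omega), sub_eq_add_neg, this, add_neg_cancel]
  · rcases Ne.lt_or_gt hne with hlt | hlt
    · refine hup ⟨(j - i).toNat, by omega, ?_⟩
      have := sh' (-i) _ _ hij
      rwa [Int.toNat_of_nonneg (by omega), sub_eq_add_neg, ← add_neg_cancel i]
    · refine hdown ⟨(i - j).toNat, by omega, ?_⟩
      have := sh' (-j) _ _ hij
      rwa [Int.toNat_of_nonneg (by omega), sub_eq_add_neg, ← add_neg_cancel j]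

theorem containsForbiddenOrDual_of_not_reversible (hP : ¬ Reversible P) :
    ContainsForbiddenOrDual P := by
  simp only [Reversible, not_forall] at hP
  obtain ⟨f, hf, hf'⟩ := hP
  simp only [Monotone, not_forall] at hf'
  obtain ⟨a, b, hab, hfab⟩ := hf'
  have hflt : StrictMono f := hf.strictMono_of_injective f.injective
  let o : P → ℤ → P := fun z n => (f ^ n) z
  have o_succ : ∀ z n, o z (n + 1) = f (o z n) := fun z n => by
    simp only [o]
    rw [add_comm, zpow_add, zpow_one, Equiv.Perm.mul_apply]
  have sh : ∀ z w, ShiftLT (o z) (o w) := fun z w i j hij => by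
    rw [o_succ, o_succ]
    exact hflt hij
  have eqsh : ∀ z w i j n, o z i = o w j → o z (i + n) = o w (j + n) := fun z w i j n hij => by
    simp only [o] at hij ⊢
    rw [add_comm i, add_comm j, zpow_add, zpow_add, Equiv.Perm.mul_apply, Equiv.Perm.mul_apply,
      hij]
  by_cases hreg : ∃ z i j, ¬ o z i < o z j ∧ o z (i + 1) < o z (j + 1)
  · obtain ⟨z, i, j, h0, h1⟩ := hreg
    exact containsForbiddenOrDual_of_irregular_orbit (o z) (sh z z) (eqsh z z) h0 h1
  have reg : ∀ z i j, o z (i + 1) < o z (j + 1) → o z i < o z j := fun z i j h1 => by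
    by_contra h0
    exact hreg ⟨z, i, j, h0, h1⟩
  set x := f.symm a with hx
  set y := f.symm b with hy
  have hxy0 : ¬ o x 0 < o y 0 := fun h => hfab (le_of_lt (by simpa [o] using h))
  have hxy1 : o x 1 < o y 1 := by
    have hne : a ≠ b := fun h => hfab (by simp [hx, hy, h])
    simpa [o, hx, hy] using lt_of_le_of_ne hab hne
  obtain ⟨p, hp, hpx⟩ := exists_isPureOrbit (o x) (sh x x) (eqsh x x) (reg x)
  obtain ⟨q, hq, hqy⟩ := exists_isPureOrbit (o y) (sh y y) (eqsh y y) (reg y)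
  have hpq : (0 : ℤ) < (p * q : ℕ) := by exact_mod_cast Nat.mul_pos hp hq
  have hshift : ∀ z w, ShiftLT (fun n => o z ((p * q : ℕ) * n)) fun n => o w ((p * q : ℕ) * n) :=
    fun z w i j hij => (sh z w).shift hij (by nlinarith) (by ring)
  have hpair : SplitPair (fun n => o x ((p * q : ℕ) * n)) fun n => o y ((p * q : ℕ) * n) := by
    refine ⟨hshift x y, hshift y x, fun i j hij => hxy0 ?_, fun n hn hlt => hxy0 ?_, fun n hn => ?_⟩
    · have key : ∀ n, o y n = o x (n + (p * q : ℕ) * (i - j)) := fun n => by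
        have := eqsh x y _ _ (n - (p * q : ℕ) * j) hij
        rw [add_sub_cancel] at this
        rw [← this]
        congr 1
        ring
      rw [key] at hxy1 ⊢
      refine reg x _ _ ?_
      convert hxy1 using 2 <;> ring
    · exact (sh x y).shift hlt (by nlinarith) (by ring)
    · exact (sh x y).shift hxy1 (by nlinarith) (by ring)
  refine hpair.containsForbiddenOrDual (hpx.comp_mul hq) ?_
  rw [mul_comm p q]
  exact hqy.comp_mul hp

end Orbits

/-- Theorem 1: a poset that is not reversible contains a subset isomorphic to some
`Fᵢ` or `Fᵢᵒᵈ`, `i = 1, …, 8`. -/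
theorem not_reversible_contains_forbidden_subset (P : Type*) [PartialOrder P]
    (hP : ¬ Reversible P) :
    ContainsCopy F1 P ∨ ContainsCopy F1ᵒᵈ P ∨
    ContainsCopy F2 P ∨ ContainsCopy F2ᵒᵈ P ∨
    ContainsCopy F3 P ∨ ContainsCopy F3ᵒᵈ P ∨
    ContainsCopy F4 P ∨ ContainsCopy F4ᵒᵈ P ∨
    ContainsCopy F5 P ∨ ContainsCopy F5ᵒᵈ P ∨
    ContainsCopy F6 P ∨ ContainsCopy F6ᵒᵈ P ∨
    ContainsCopy F7 P ∨ ContainsCopy F7ᵒᵈ P ∨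
    ContainsCopy F8 P ∨ ContainsCopy F8ᵒᵈ P := by
  rcases containsForbiddenOrDual_of_not_reversible hP with h | h
  · rcases h with h | h | h | h | h | h | h | h <;> tauto
  · rcases h with h | h | h | h | h | h | h | h <;> have := h.dual <;> tauto
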